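/- If p < m, then the complex vector space of all E*-valued alternating (p+1)-linear maps on E* is the internal direct sum of the image of j and the kernel of c; that is, range(j) ∩ ker(c) = {0} and every E*-valued alternating (p+1)-linear map on E* is the sum of an element of range(j) and an element of ker(c). -/

import Mathlib

open Module

/-- The map `j`: given a `ℂ`-valued alternating `p`-linear map `ψ` on `E*`, the
`E*`-valued `(p+1)`-linear map
`j(ψ)(x₁, …, x_{p+1}) = p! · Σ_k (−1)^{k−1} ψ(x₁, …, x̂_k, …, x_{p+1}) · x_k`
(written here as a raw function). -/
noncomputable def jRaw {E : Type*} [AddCommGroup E] [Module ℂ E] {p : ℕ}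
    (ψ : (Module.Dual ℂ E) [⋀^(Fin p)]→ₗ[ℂ] ℂ) :
    (Fin (p + 1) → Module.Dual ℂ E) → Module.Dual ℂ E :=
  fun x =>
    (p.factorial : ℂ) •
      ∑ k : Fin (p + 1), ((-1 : ℂ) ^ (k : ℕ)) •
        ((ψ fun i => x (k.succAbove i)) • x k)

/-- The contraction map `c`: given an `E*`-valued `(p+1)`-linear map `φ` on `E*`
(as a raw function) and a basis `ξ` of `E` with dual basis `ξ*`, the `ℂ`-valued
`p`-linear map `c(φ)(x₁, …, x_p) = Σ_k φ(ξ_k*, x₁, …, x_p)(ξ_k)`. -/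
noncomputable def cRaw {E : Type*} [AddCommGroup E] [Module ℂ E] {m p : ℕ}
    (ξ : Basis (Fin m) ℂ E)
    (φ : (Fin (p + 1) → Module.Dual ℂ E) → Module.Dual ℂ E) :
    (Fin p → Module.Dual ℂ E) → ℂ :=
  fun x => ∑ k : Fin m, (φ (Fin.cons (ξ.dualBasis k) x)) (ξ k)


theorem AlternatingMap.neg_one_pow_smul_map_cons_comp_succ_succAbove {R M N : Type*} [CommRing R]
    [AddCommGroup M] [Module R M] [AddCommGroup N] [Module R N] {p : ℕ}
    (ψ : M [⋀^(Fin p)]→ₗ[R] N) (a : M) (x : Fin p → M) (l : Fin p) :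
    ((-1 : R) ^ (l : ℕ)) • ψ (fun i => (Fin.cons a x : Fin (p + 1) → M) (l.succ.succAbove i)) =
      ψ (Function.update x l a) := by
  cases p with
  | zero => exact l.elim0
  | succ n =>
    have h : (fun i => (Fin.cons a x : Fin (n + 2) → M) (l.succ.succAbove i)) =
        Matrix.vecCons a (l.removeNth x) := by
      funext i
      refine Fin.cases ?_ (fun i => ?_) i <;> simp [Fin.removeNth]
    rw [h, ← Fin.insertNth_removeNth, ψ.map_insertNth, ← Int.cast_smul_eq_zsmul R]
    simp

theorem sum_dualBasis_smul_map_update {E N : Type*} [AddCommGroup E] [Module ℂ E]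
    [AddCommGroup N] [Module ℂ N] {m p : ℕ} (ξ : Basis (Fin m) ℂ E)
    (ψ : (Module.Dual ℂ E) [⋀^(Fin p)]→ₗ[ℂ] N) (x : Fin p → Module.Dual ℂ E) (l : Fin p) :
    ∑ k : Fin m, x l (ξ k) • ψ (Function.update x l (ξ.dualBasis k)) = ψ x := by
  have h : ∑ k : Fin m, x l (ξ k) • ξ.dualBasis k = x l := by
    simpa only [Basis.dualBasis_repr] using ξ.dualBasis.sum_repr (x l)
  conv_rhs => rw [← Function.update_eq_self l x, ← h, ψ.map_update_sum]
  simp only [ψ.map_update_smul]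

theorem cRaw_jRaw {E : Type*} [AddCommGroup E] [Module ℂ E] {m p : ℕ} (ξ : Basis (Fin m) ℂ E)
    (ψ : (Module.Dual ℂ E) [⋀^(Fin p)]→ₗ[ℂ] ℂ) (x : Fin p → Module.Dual ℂ E) :
    cRaw ξ (jRaw ψ) x = (p.factorial : ℂ) * ((m : ℂ) - p) * ψ x := by
  have h (k : Fin m) : jRaw ψ (Fin.cons (ξ.dualBasis k) x) (ξ k) = (p.factorial : ℂ) *
      (ψ x - ∑ l, x l (ξ k) • ψ (Function.update x l (ξ.dualBasis k))) := by
    simp only [jRaw, Fin.sum_univ_succ, ← ψ.neg_one_pow_smul_map_cons_comp_succ_succAbove]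
    simp [pow_succ, sub_eq_add_neg, mul_add, mul_comm, mul_left_comm]
  simp only [cRaw, h, ← Finset.mul_sum, Finset.sum_sub_distrib]
  rw [Finset.sum_comm]
  simp only [sum_dualBasis_smul_map_update]
  simp
  ring

/-- `jRaw ψ` as an alternating map. -/
noncomputable def jAlternating {E : Type*} [AddCommGroup E] [Module ℂ E] {p : ℕ}
    (ψ : (Module.Dual ℂ E) [⋀^(Fin p)]→ₗ[ℂ] ℂ) :
    (Module.Dual ℂ E) [⋀^(Fin (p + 1))]→ₗ[ℂ] (Module.Dual ℂ E) :=
  (p.factorial : ℂ) • AlternatingMap.alternatizeUncurryFin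
    { toFun := fun y => (LinearMap.toSpanSingleton ℂ _ y).compAlternatingMap ψ
      map_add' := fun y z => by ext; simp
      map_smul' := fun a y => by ext; simp; ring }

theorem jAlternating_apply {E : Type*} [AddCommGroup E] [Module ℂ E] {p : ℕ}
    (ψ : (Module.Dual ℂ E) [⋀^(Fin p)]→ₗ[ℂ] ℂ) (x : Fin (p + 1) → Module.Dual ℂ E) :
    jAlternating ψ x = jRaw ψ x := by
  have h (k : ℕ) (y : Module.Dual ℂ E) : ((-1 : ℤ) ^ k) • y = ((-1 : ℂ) ^ k) • y := by
    rw [← Int.cast_smul_eq_zsmul ℂ]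
    simp
  simp [jAlternating, jRaw, AlternatingMap.alternatizeUncurryFin_apply, h]
  rfl

/-- `cRaw ξ φ` as an alternating map. -/
noncomputable def cAlternating {E : Type*} [AddCommGroup E] [Module ℂ E] {m p : ℕ}
    (ξ : Basis (Fin m) ℂ E)
    (φ : (Module.Dual ℂ E) [⋀^(Fin (p + 1))]→ₗ[ℂ] (Module.Dual ℂ E)) :
    (Module.Dual ℂ E) [⋀^(Fin p)]→ₗ[ℂ] ℂ :=
  ∑ k : Fin m, (Module.Dual.eval ℂ E (ξ k)).compAlternatingMap (φ.curryLeft (ξ.dualBasis k))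

theorem cAlternating_apply {E : Type*} [AddCommGroup E] [Module ℂ E] {m p : ℕ}
    (ξ : Basis (Fin m) ℂ E)
    (φ : (Module.Dual ℂ E) [⋀^(Fin (p + 1))]→ₗ[ℂ] (Module.Dual ℂ E))
    (x : Fin p → Module.Dual ℂ E) : cAlternating ξ φ x = cRaw ξ φ x := by
  let ev : ((Module.Dual ℂ E) [⋀^(Fin p)]→ₗ[ℂ] ℂ) →+ ℂ :=
    { toFun := fun f => f x, map_zero' := rfl, map_add' := fun _ _ => rfl }
  exact map_sum ev _ _

/-- If `p < m = dim E`, then the space of all `E*`-valued alternating `(p+1)`-linear maps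
on `E*` is the internal direct sum of the image of `j` and the kernel of the contraction
`c`: the intersection is zero, and every such map is a sum of an element of the range of
`j` and an element of the kernel of `c`. -/
theorem range_jRaw_disjoint_and_sup_ker_cRaw (E : Type*) [AddCommGroup E] [Module ℂ E]
    (m : ℕ) (ξ : Basis (Fin m) ℂ E) (p : ℕ) (hpm : p < m) :
    (∀ φ : (Module.Dual ℂ E) [⋀^(Fin (p + 1))]→ₗ[ℂ] (Module.Dual ℂ E),
        (∃ ψ : (Module.Dual ℂ E) [⋀^(Fin p)]→ₗ[ℂ] ℂ, ∀ x, φ x = jRaw ψ x) →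
        (∀ x, cRaw ξ (⇑φ) x = 0) → φ = 0) ∧
      (∀ φ : (Module.Dual ℂ E) [⋀^(Fin (p + 1))]→ₗ[ℂ] (Module.Dual ℂ E),
        ∃ (ψ : (Module.Dual ℂ E) [⋀^(Fin p)]→ₗ[ℂ] ℂ)
          (χ : (Module.Dual ℂ E) [⋀^(Fin (p + 1))]→ₗ[ℂ] (Module.Dual ℂ E)),
            (∀ x, cRaw ξ (⇑χ) x = 0) ∧ ∀ x, φ x = jRaw ψ x + χ x) := by
  have hd : (p.factorial : ℂ) * ((m : ℂ) - p) ≠ 0 :=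
    mul_ne_zero (by exact_mod_cast p.factorial_ne_zero)
      (sub_ne_zero.mpr (by exact_mod_cast hpm.ne'))
  constructor
  · rintro φ ⟨ψ, hψ⟩ hφ
    have hψ0 : ψ = 0 := by
      ext x
      have h := hφ x
      rw [show ⇑φ = jRaw ψ from funext hψ, cRaw_jRaw] at h
      exact (mul_eq_zero.mp h).resolve_left hd
    ext1 x
    simp [hψ, hψ0, jRaw]
  · intro φ
    set ψ := ((p.factorial : ℂ) * ((m : ℂ) - p))⁻¹ • cAlternating ξ φ with hψ
    refine ⟨ψ, φ - jAlternating ψ, fun x => ?_, fun x => by simp [jAlternating_apply]⟩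
    have h : cRaw ξ (⇑(φ - jAlternating ψ)) x = cRaw ξ φ x - cRaw ξ (jRaw ψ) x := by
      simp [cRaw, jAlternating_apply]
    rw [h, cRaw_jRaw, hψ, AlternatingMap.smul_apply, cAlternating_apply, smul_eq_mul,
      mul_inv_cancel_left₀ hd, sub_self]
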